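/- Let n ≥ 2 and let −1 = x_0 < x_1 < ⋯ < x_n = 1 be the n+1 roots of (1−x²)P_n'(x), where P_n is the Legendre polynomial of degree n (the Gauss–Legendre–Lobatto points). Let λ_j := 1/∏_{k≠j}(x_j − x_k) be the barycentric weights and w_j := ∫_{−1}^1 ∏_{k≠j}((x − x_k)/(x_j − x_k)) dx the Gauss–Legendre–Lobatto quadrature weights. Then there is a nonzero constant c, independent of j, such that λ_j = c (−1)^j √(w_j) for all j = 0,…,n. -/

import Mathlib

open MeasureTheory Finset Real

/-- The Legendre polynomial `P_n` defined by the Rodrigues formula. -/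
noncomputable def legendreP (n : ℕ) : ℝ → ℝ := fun x =>
  (1 / ((2 : ℝ) ^ n * (Nat.factorial n : ℝ)))
    * deriv^[n] (fun t => (t ^ 2 - 1) ^ n) x

open Polynomial in
/-- The integration functional on polynomials. -/
noncomputable def polyInt (q : ℝ[X]) : ℝ := ∫ t in (-1 : ℝ)..1, q.eval t

section helpers
open Polynomial

lemma polyInt_ii (q : ℝ[X]) : IntervalIntegrable (fun t => q.eval t) volume (-1) 1 :=
  (Polynomial.continuous q).intervalIntegrable _ _

lemma polyInt_add (p q : ℝ[X]) : polyInt (p + q) = polyInt p + polyInt q := by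
  unfold polyInt
  rw [← intervalIntegral.integral_add (polyInt_ii p) (polyInt_ii q)]
  simp

lemma polyInt_C_mul (a : ℝ) (q : ℝ[X]) : polyInt (C a * q) = a * polyInt q := by
  unfold polyInt
  rw [← intervalIntegral.integral_const_mul]
  simp

lemma polyInt_derivative (q : ℝ[X]) : polyInt (derivative q) = q.eval 1 - q.eval (-1) := by
  unfold polyInt
  refine intervalIntegral.integral_eq_sub_of_hasDerivAt (f := fun t => q.eval t)
    (f' := fun t => (derivative q).eval t) ?_ ?_
  · intro t _
    exact q.hasDerivAt t
  · exact polyInt_ii _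

lemma polyInt_parts (p q : ℝ[X]) (h1 : p.eval 1 = 0) (h2 : p.eval (-1) = 0) :
    polyInt (derivative p * q) = - polyInt (p * derivative q) := by
  have h := polyInt_derivative (p * q)
  rw [derivative_mul, polyInt_add] at h
  simp [h1, h2] at h
  linarith

lemma polyInt_sq_pos (q : ℝ[X]) (hq : q ≠ 0) : 0 < polyInt (q * q) := by
  unfold polyInt
  obtain ⟨c, hc, hcne⟩ : ∃ c ∈ Set.Icc (-1 : ℝ) 1, q.eval c ≠ 0 := by
    by_contra! h
    apply hq
    apply Polynomial.eq_zero_of_infinite_isRoot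
    exact (Set.Icc_infinite (by norm_num : (-1 : ℝ) < 1)).mono (fun c hc => h c hc)
  apply intervalIntegral.integral_pos (by norm_num)
  · exact (Polynomial.continuous _).continuousOn
  · intro t _
    simpa using mul_self_nonneg (q.eval t)
  · refine ⟨c, hc, ?_⟩
    simpa using mul_self_pos.2 hcne

/-- `(X^2-1)^n`. -/
noncomputable def legU (n : ℕ) : ℝ[X] := (X ^ 2 - 1) ^ n

/-- Unnormalized Legendre polynomial. -/
noncomputable def legQ (n : ℕ) : ℝ[X] := derivative^[n] (legU n)

lemma legU_eval (n k : ℕ) (hk : k < n) (c : ℝ) (hc : c ^ 2 = 1) :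
    (derivative^[k] (legU n)).eval c = 0 := by
  have h : (X ^ 2 - 1 : ℝ[X]) ^ (n - k) ∣ derivative^[k] (legU n) :=
    Polynomial.pow_sub_dvd_iterate_derivative_of_pow_dvd k (dvd_refl _)
  have h2 : (X ^ 2 - 1 : ℝ[X]) ∣ derivative^[k] (legU n) :=
    (dvd_pow_self _ (by omega)).trans h
  obtain ⟨r, hr⟩ := h2
  rw [hr]
  simp [hc]

lemma legU_orth (n k : ℕ) (hk : k ≤ n) : ∀ q : ℝ[X], derivative^[k] q = 0 →
    polyInt (derivative^[k] (legU n) * q) = 0 := by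
  induction k with
  | zero => intro q hq; simp at hq; simp [hq, polyInt]
  | succ k ih =>
    intro q hq
    rw [Function.iterate_succ_apply', polyInt_parts, ih (by omega) (derivative q), neg_zero]
    · rwa [Function.iterate_succ_apply] at hq
    · exact legU_eval n k (by omega) _ (by norm_num)
    · exact legU_eval n k (by omega) _ (by norm_num)

lemma legQ_orth (n : ℕ) (q : ℝ[X]) (hq : q.degree < (n : WithBot ℕ)) : polyInt (legQ n * q) = 0 := by
  apply legU_orth n n le_rfl
  by_cases h0 : q = 0
  · simp [h0]
  · exact Polynomial.iterate_derivative_eq_zero ((natDegree_lt_iff_degree_lt h0).2 hq)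

lemma legQ_int (n : ℕ) (q : ℝ[X]) (hq : q.natDegree ≤ n) :
    polyInt (legQ n * q) = q.coeff n * polyInt (legQ n * X ^ n) := by
  have h : q = C (q.coeff n) * X ^ n + (q - C (q.coeff n) * X ^ n) := by ring
  have h2 : (q - C (q.coeff n) * X ^ n).degree < (n : WithBot ℕ) := by
    rw [degree_lt_iff_coeff_zero]
    intro m hm
    rcases hm.eq_or_lt with rfl | hm
    · simp
    · simp [coeff_X_pow, hm.ne', coeff_eq_zero_of_natDegree_lt (hq.trans_lt hm)]
  conv_lhs => rw [h]
  rw [mul_add, polyInt_add, legQ_orth n _ h2, add_zero, ← polyInt_C_mul]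
  congr 1
  ring

lemma legU_ode_aux (n k : ℕ) :
    (X ^ 2 - 1) * derivative^[k + 2] (legU n)
      + 2 * ((k : ℝ[X]) + 1) * X * derivative^[k + 1] (legU n)
      + ((k : ℝ[X]) + 1) * (k : ℝ[X]) * derivative^[k] (legU n)
      - 2 * (n : ℝ[X]) * X * derivative^[k + 1] (legU n)
      - 2 * (n : ℝ[X]) * ((k : ℝ[X]) + 1) * derivative^[k] (legU n)
      = 0 := by
  induction k with
  | zero =>
    have h : (X ^ 2 - 1) * derivative (legU n) = 2 * (n : ℝ[X]) * X * legU n := by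
      unfold legU
      rcases n with _ | n
      · simp
      · have h2 : (C 2 : ℝ[X]) = 2 := rfl
        simp [derivative_pow, h2]
        ring
    have h := congrArg derivative h
    simp only [Function.iterate_succ_apply', Function.iterate_zero, id]
    simp at h ⊢
    linear_combination h
  | succ k ih =>
    have h := congrArg derivative ih
    simp only [Function.iterate_succ_apply'] at h ⊢
    simp at h ⊢
    linear_combination h

lemma legQ_ode (n : ℕ) :
    derivative ((X ^ 2 - 1) * derivative (legQ n)) = (n : ℝ[X]) * ((n : ℝ[X]) + 1) * legQ n := by
  have h := legU_ode_aux n n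
  simp only [Function.iterate_succ_apply'] at h
  simp only [legQ]
  simp
  linear_combination h

lemma legU_monic (n : ℕ) : (legU n).Monic := by
  unfold legU
  apply Monic.pow
  have := monic_X_pow_sub_C (1 : ℝ) (two_ne_zero)
  simpa using this

lemma legU_natDegree (n : ℕ) : (legU n).natDegree = 2 * n := by
  unfold legU
  have := natDegree_X_pow_sub_C (n := 2) (r := (1 : ℝ))
  rw [natDegree_pow]
  simp at this
  rw [this, mul_comm]

lemma legQ_natDegree_le (n : ℕ) : (legQ n).natDegree ≤ n := by
  unfold legQ
  have := natDegree_iterate_derivative (legU n) n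
  rw [legU_natDegree] at this
  omega

lemma legQ_coeff (n : ℕ) : (legQ n).coeff n ≠ 0 := by
  unfold legQ
  rw [coeff_iterate_derivative]
  have h : (legU n).coeff (n + n) = 1 := by
    have := (legU_monic n).coeff_natDegree
    rwa [legU_natDegree, two_mul] at this
  rw [h]
  have : (n + n).descFactorial n ≠ 0 := by
    rw [Ne, Nat.descFactorial_eq_zero_iff_lt]; omega
  simpa using this

lemma legP_eq (n : ℕ) : legendreP n =
    fun x => (1 / ((2 : ℝ) ^ n * (Nat.factorial n : ℝ))) * (legQ n).eval x := by
  have key : ∀ (k : ℕ) (p : ℝ[X]),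
      deriv^[k] (fun t => p.eval t) = fun t => (derivative^[k] p).eval t := by
    intro k
    induction k with
    | zero => intro p; rfl
    | succ k ih =>
      intro p
      rw [Function.iterate_succ_apply, Function.iterate_succ_apply, ← ih]
      congr 1
      funext t
      exact p.deriv
  funext x
  unfold legendreP legQ
  have h := congrFun (key n (legU n)) x
  rw [← h]
  simp [legU]

lemma legP_deriv (n : ℕ) (x : ℝ) (h : deriv (legendreP n) x = 0) :
    (derivative (legQ n)).eval x = 0 := by
  rw [legP_eq] at h
  rw [deriv_const_mul _ (legQ n).differentiableAt, Polynomial.deriv] at h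
  rcases mul_eq_zero.1 h with h | h
  · exfalso
    have : (0 : ℝ) < 1 / ((2 : ℝ) ^ n * (Nat.factorial n : ℝ)) := by positivity
    linarith
  · exact h

lemma sign_prod (n : ℕ) (x : Fin (n + 1) → ℝ) (hx : StrictMono x) (j : Fin (n + 1)) :
    0 < (-1 : ℝ) ^ (n + (j : ℕ)) * ∏ k ∈ Finset.univ.erase j, (x j - x k) := by
  have h : (Finset.univ.erase j : Finset (Fin (n+1))) = Finset.Iio j ∪ Finset.Ioi j := by
    ext k; simp [lt_or_lt_iff_ne]
  rw [h, Finset.prod_union]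
  · have h1 : 0 < ∏ k ∈ Finset.Iio j, (x j - x k) :=
      Finset.prod_pos fun k hk => sub_pos.2 (hx (Finset.mem_Iio.1 hk))
    have h2 : 0 < ∏ k ∈ Finset.Ioi j, (x k - x j) :=
      Finset.prod_pos fun k hk => sub_pos.2 (hx (Finset.mem_Ioi.1 hk))
    have h3 : ∏ k ∈ Finset.Ioi j, (x j - x k)
        = (-1 : ℝ) ^ (n - (j : ℕ)) * ∏ k ∈ Finset.Ioi j, (x k - x j) := by
      have hc : (Finset.Ioi j).card = n - (j : ℕ) := by simp [Fin.card_Ioi]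
      rw [← hc, ← Finset.prod_const, ← Finset.prod_mul_distrib]
      exact Finset.prod_congr rfl fun k _ => by ring
    have h4 : (-1 : ℝ) ^ (n + (j : ℕ)) * (-1 : ℝ) ^ (n - (j : ℕ)) = 1 := by
      rw [← pow_add]
      have : n + (j : ℕ) + (n - (j : ℕ)) = 2 * n := by have := j.2; omega
      rw [this, pow_mul]; simp
    rw [h3]
    calc (0 : ℝ) < (∏ k ∈ Finset.Iio j, (x j - x k)) * ∏ k ∈ Finset.Ioi j, (x k - x j) :=
          mul_pos h1 h2
      _ = ((-1 : ℝ) ^ (n + (j : ℕ)) * (-1 : ℝ) ^ (n - (j : ℕ))) *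
          ((∏ k ∈ Finset.Iio j, (x j - x k)) * ∏ k ∈ Finset.Ioi j, (x k - x j)) := by
          rw [h4, one_mul]
      _ = _ := by ring
  · rw [Finset.disjoint_left]
    intro k hk hkk
    exact lt_asymm (Finset.mem_Iio.1 hk) (Finset.mem_Ioi.1 hkk)

/-- The node polynomial is proportional to the derivative of P_n times X²-1. -/
lemma node_poly (n : ℕ) (hn : 2 ≤ n) (x : Fin (n + 1) → ℝ) (hx_mono : StrictMono x)
    (hx_root : ∀ j, (1 - (x j) ^ 2) * (derivative (legQ n)).eval (x j) = 0) :
    (X ^ 2 - 1) * derivative (legQ n)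
      = C (n * (legQ n).coeff n) * ∏ k, (X - C (x k)) := by
  have hL : (∏ k, (X - C (x k))).Monic := monic_prod_of_monic _ _ fun k _ => monic_X_sub_C _
  have hLd : (∏ k, (X - C (x k))).natDegree = n + 1 := by
    rw [natDegree_prod_of_monic _ _ fun k _ => monic_X_sub_C _]
    simp
  have hdQ : (derivative (legQ n)).natDegree ≤ n - 1 :=
    (natDegree_derivative_le _).trans (Nat.sub_le_sub_right (legQ_natDegree_le n) 1)
  have hX : (X ^ 2 - 1 : ℝ[X]).natDegree ≤ 2 := by
    compute_degree
  have hA : ((X ^ 2 - 1) * derivative (legQ n)).natDegree ≤ n + 1 := by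
    refine natDegree_mul_le.trans ?_
    omega
  have hAc : ((X ^ 2 - 1) * derivative (legQ n)).coeff (n + 1) = n * (legQ n).coeff n := by
    have h := coeff_mul_add_eq_of_natDegree_le hX hdQ
    have e : 2 + (n - 1) = n + 1 := by omega
    rw [e] at h
    rw [h, coeff_derivative]
    have e2 : n - 1 + 1 = n := by omega
    have e3 : ((n - 1 : ℕ) : ℝ) + 1 = n := by exact_mod_cast e2
    rw [e2, e3]
    simp [coeff_X_pow, coeff_one]
    ring
  rw [← sub_eq_zero]
  refine Polynomial.eq_zero_of_degree_lt_of_eval_finset_eq_zero (Finset.univ.image x) ?_ ?_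
  · rw [Finset.card_image_of_injective _ hx_mono.injective, Finset.card_univ, Fintype.card_fin,
      degree_lt_iff_coeff_zero]
    intro m hm
    rw [coeff_sub, coeff_C_mul]
    rcases hm.eq_or_lt with rfl | hm
    · have : (∏ k, (X - C (x k))).coeff (n + 1) = 1 := by
        have h := hL.coeff_natDegree
        rwa [hLd] at h
      rw [hAc, this]; ring
    · rw [coeff_eq_zero_of_natDegree_lt (hA.trans_lt hm),
        coeff_eq_zero_of_natDegree_lt (hLd.trans_lt hm)]; ring
  · intro y hy
    obtain ⟨j, -, rfl⟩ := Finset.mem_image.1 hy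
    have h0 : (∏ k, (X - C (x k))).eval (x j) = 0 := by
      rw [eval_prod]
      exact Finset.prod_eq_zero (Finset.mem_univ j) (by simp)
    rw [eval_sub, eval_mul, eval_mul, h0]
    have := hx_root j
    simp only [eval_sub, eval_pow, eval_X, eval_one]
    linear_combination -this

lemma main_poly (n : ℕ) (hn : 2 ≤ n) (x : Fin (n + 1) → ℝ) (hx_mono : StrictMono x)
    (hx_root : ∀ j, (1 - (x j) ^ 2) * (derivative (legQ n)).eval (x j) = 0)
    (j : Fin (n + 1)) :
    ((n : ℝ) + 1) * (legQ n).eval (x j)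
        = (legQ n).coeff n * ∏ k ∈ Finset.univ.erase j, (x j - x k) ∧
    n * ((legQ n).eval (x j) * polyInt (∏ k ∈ Finset.univ.erase j, (X - C (x k))))
      = (2 * n + 1) * polyInt (legQ n * X ^ n) := by
  have hnode := node_poly n hn x hx_mono hx_root
  have hode := legQ_ode n
  have hp := legQ_coeff n
  have hn0 : (n : ℝ) ≠ 0 := by positivity
  set p := (legQ n).coeff n with hpdef
  set M : ℝ[X] := ∏ k ∈ Finset.univ.erase j, (X - C (x k)) with hM
  have hL : ∏ k, (X - C (x k)) = (X - C (x j)) * M :=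
    (Finset.mul_prod_erase _ _ (Finset.mem_univ j)).symm
  have hMm : M.Monic := monic_prod_of_monic _ _ fun k _ => monic_X_sub_C _
  have hMd : M.natDegree = n := by
    rw [hM, natDegree_prod_of_monic _ _ fun k _ => monic_X_sub_C _]
    simp
  have hMe : M.eval (x j) = ∏ k ∈ Finset.univ.erase j, (x j - x k) := by
    rw [hM, eval_prod]; simp
  rw [hL] at hnode
  constructor
  · rw [hnode] at hode
    have h := congrArg (eval (x j)) hode
    simp at h
    rw [hMe] at h
    apply mul_left_cancel₀ hn0
    linear_combination -h
  · obtain ⟨r, hr⟩ : (X - C (x j)) ∣ legQ n - C ((legQ n).eval (x j)) := by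
      rw [dvd_iff_isRoot]; simp
    have hrd : r.natDegree ≤ n - 1 := by
      have h1 : (legQ n - C ((legQ n).eval (x j))).natDegree ≤ n := by
        rw [natDegree_sub_C]; exact legQ_natDegree_le n
      rw [hr] at h1
      by_cases h0 : r = 0
      · simp [h0]
      · rw [natDegree_mul (X_sub_C_ne_zero _) h0, natDegree_X_sub_C] at h1
        omega
    have hrc : r.coeff (n - 1) = p := by
      have h := coeff_mul_add_eq_of_natDegree_le (natDegree_X_sub_C_le (x j)) hrd
      rw [← hr, show 1 + (n - 1) = n by omega, coeff_sub, coeff_C, if_neg (by omega)] at h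
      simp at h
      rw [hpdef, h]
    have hX : (X ^ 2 - 1 : ℝ[X]).natDegree ≤ 2 := by
      compute_degree
    -- the derivative of (X²-1) r
    have hsd : (derivative ((X ^ 2 - 1) * r)).natDegree ≤ n := by
      refine (natDegree_derivative_le _).trans ?_
      have := natDegree_mul_le (p := (X ^ 2 - 1 : ℝ[X])) (q := r)
      omega
    have hsc : (derivative ((X ^ 2 - 1) * r)).coeff n = p * (n + 1) := by
      have h := coeff_mul_add_eq_of_natDegree_le hX hrd
      rw [show 2 + (n - 1) = n + 1 by omega] at h
      rw [coeff_derivative, h, hrc]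
      simp [coeff_X_pow, coeff_one]
    have e1 : polyInt (legQ n * derivative ((X ^ 2 - 1) * r))
        = p * (n + 1) * polyInt (legQ n * X ^ n) := by
      rw [legQ_int n _ hsd, hsc]
    have e2 : polyInt (legQ n * M) = polyInt (legQ n * X ^ n) := by
      rw [legQ_int n M hMd.le]
      have : M.coeff n = 1 := by rw [← hMd]; exact hMm.coeff_natDegree
      rw [this, one_mul]
    have e3 := polyInt_parts ((X ^ 2 - 1) * r) (legQ n) (by simp) (by simp)
    have e4 : (X ^ 2 - 1) * r * derivative (legQ n)
        = C (n * p) * (M * legQ n) + C (n * p * (- (legQ n).eval (x j))) * M := by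
      rw [mul_right_comm, hnode]
      simp only [C_mul, C_neg]
      linear_combination (-(C (n : ℝ) * C p * M)) * hr
    rw [e4, polyInt_add, polyInt_C_mul, polyInt_C_mul, mul_comm M, e2, mul_comm _ (legQ n), e1]
      at e3
    apply mul_left_cancel₀ hp
    linear_combination -e3

end helpers

/-- **Corollary 3.7: barycentric weights at Gauss–Legendre–Lobatto points.**
Let `-1 = x_0 < ⋯ < x_n = 1` be the roots of `(1-x²)P_n'(x)` and let `w_j` be the
Gauss–Legendre–Lobatto quadrature weights.  Then there is a nonzero constant `c`,
independent of `j`, with `λ_j = c (-1)^j √(w_j)` for all `j`. -/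
theorem barycentric_legendre_lobatto
    (n : ℕ) (hn : 2 ≤ n) (x : Fin (n + 1) → ℝ)
    (hx_mono : StrictMono x)
    (hx0 : x 0 = -1) (hxn : x (Fin.last n) = 1)
    (hx_root : ∀ j, (1 - (x j) ^ 2) * deriv (legendreP n) (x j) = 0)
    (lam w : Fin (n + 1) → ℝ)
    (hlam : ∀ j, lam j = (∏ k ∈ Finset.univ.erase j, (x j - x k))⁻¹)
    (hw : ∀ j, w j = ∫ t in (-1 : ℝ)..1,
      ∏ k ∈ Finset.univ.erase j, ((t - x k) / (x j - x k))) :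
    ∃ c : ℝ, c ≠ 0 ∧
      ∀ j : Fin (n + 1), lam j = c * (-1 : ℝ) ^ (j : ℕ) * Real.sqrt (w j) := by
  have hroot : ∀ j, (1 - (x j) ^ 2) * (Polynomial.derivative (legQ n)).eval (x j) = 0 := by
    intro j
    rcases mul_eq_zero.1 (hx_root j) with h | h
    · rw [h, zero_mul]
    · rw [legP_deriv n _ h, mul_zero]
  have hmain := main_poly n hn x hx_mono hroot
  have hn0 : (0 : ℝ) < n := by positivity
  have hp := legQ_coeff n
  set p := (legQ n).coeff n with hpdef
  set I := polyInt (legQ n * Polynomial.X ^ n) with hI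
  have hpI : 0 < p * I := by
    rw [hpdef, hI, ← legQ_int n (legQ n) (legQ_natDegree_le n)]
    apply polyInt_sq_pos
    intro h
    rw [hpdef, h] at hp
    simp at hp
  -- the constant `K` with `w_j = K λ_j²`
  obtain ⟨K, hK⟩ : ∃ K : ℝ, K = (2 * n + 1) * (n + 1) * (p * I) / (n * p ^ 2) := ⟨_, rfl⟩
  have hKpos : 0 < K := by
    rw [hK]; positivity
  have hwK : ∀ j, w j = K * lam j ^ 2 := by
    intro j
    obtain ⟨h1, h2⟩ := hmain j
    have hs := sign_prod n x hx_mono j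
    have hw' : w j = lam j *
        polyInt (∏ k ∈ Finset.univ.erase j, (Polynomial.X - Polynomial.C (x k))) := by
      rw [hw j, hlam j, polyInt, ← intervalIntegral.integral_const_mul]
      congr 1
      funext t
      rw [Finset.prod_div_distrib, Polynomial.eval_prod]
      simp [div_eq_inv_mul]
    rw [hw', hK, hlam j]
    set m := ∏ k ∈ Finset.univ.erase j, (x j - x k) with hm
    have hm0 : m ≠ 0 := by
      intro h; rw [h] at hs; simp at hs
    set J := polyInt (∏ k ∈ Finset.univ.erase j, (Polynomial.X - Polynomial.C (x k)))
    field_simp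
    linear_combination (-(n : ℝ) * J) * h1 + ((n : ℝ) + 1) * h2
  have hsK : 0 < Real.sqrt K := Real.sqrt_pos.2 hKpos
  refine ⟨(-1) ^ n / Real.sqrt K, by positivity, ?_⟩
  intro j
  have hs := sign_prod n x hx_mono j
  have hsq : ((-1 : ℝ) ^ (n + (j : ℕ))) * ((-1 : ℝ) ^ (n + (j : ℕ))) = 1 := by
    rw [← pow_add, ← two_mul, pow_mul]; simp
  have habs : |lam j| = (-1 : ℝ) ^ (n + (j : ℕ)) * lam j := by
    have h1 : 0 < (-1 : ℝ) ^ (n + (j : ℕ)) * lam j := by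
      rw [hlam j]
      have := inv_pos.2 hs
      rw [mul_inv, ← inv_pow] at this
      norm_num at this ⊢
      exact this
    rw [← abs_of_pos h1, abs_mul]
    simp
  rw [hwK j, Real.sqrt_mul hKpos.le, Real.sqrt_sq_eq_abs, habs]
  rw [pow_add] at hsq ⊢
  field_simp
  linear_combination (-lam j) * hsq
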